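/- Suppose there is a constant λ ∈ ℝ with λ ≠ 0 and λ² ≠ 1 such that f31 = λ·f11, with f11 nowhere zero and f11′ nowhere zero. Assume the structure equations (S1)–(S3) hold and ∂F/∂z_k is nowhere zero. Then at every point (z0,…,z_{k−1}) ∈ ℝ^k: (i) ∂f12/∂z_{k−1} ≠ 0; (ii) ∂f32/∂z_{k−1} = λ·∂f12/∂z_{k−1}; (iii) ∂f22/∂z_{k−2} = 0; and (iv) ∂f32/∂z_{k−2} − λ·∂f12/∂z_{k−2} = η·(λ² − 1)·∂f12/∂z_{k−1}, which is nonzero. -/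

import Mathlib

open Real Finset

/-- Partial derivative of `f` at `z` in the `i`-th coordinate direction. -/
noncomputable def pd {n : ℕ} (f : (Fin n → ℝ) → ℝ) (z : Fin n → ℝ) (i : ℕ) : ℝ :=
  fderiv ℝ f z (fun j => if (j : ℕ) = i then 1 else 0)

/-- The `i`-th coordinate of `z` (junk value `0` out of range). -/
def zc {n : ℕ} (z : Fin n → ℝ) (i : ℕ) : ℝ :=
  if h : i < n then z ⟨i, h⟩ else 0

/-- `f` depends only on the first `m` coordinates `z_0, …, z_{m-1}`. -/
def DependsOnFirst {n : ℕ} (m : ℕ) (f : (Fin n → ℝ) → ℝ) : Prop :=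
  ∀ z w : Fin n → ℝ, (∀ j : Fin n, (j : ℕ) < m → z j = w j) → f z = f w

/-- The structure equations (S1)–(S3), required at every point `(z_0, …, z_k) ∈ ℝ^{k+1}`. -/
def StructEqs (k : ℕ) (η : ℝ) (f11 f31 : ℝ → ℝ)
    (f12 f22 f32 F : (Fin (k+1) → ℝ) → ℝ) : Prop :=
  ∀ z : Fin (k+1) → ℝ,
    deriv f11 (z 0) * F z =
      (∑ i ∈ Finset.range k, pd f12 z i * zc z (i+1)) + η * f32 z - f31 (z 0) * f22 z ∧
    (∑ i ∈ Finset.range (k-1), pd f22 z i * zc z (i+1)) =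
      f11 (z 0) * f32 z - f31 (z 0) * f12 z ∧
    deriv f31 (z 0) * F z =
      (∑ i ∈ Finset.range k, pd f32 z i * zc z (i+1)) + η * f12 z - f11 (z 0) * f22 z

/-- The Codazzi identities (C1) and (C2), required for every `(x,t) ∈ U` and every
`(z_0, …, z_{k-1})` (equivalently, every `z ∈ ℝ^{k+1}` since the data does not
depend on `z_k`).  Here `(1,0)` is the `∂/∂x` direction and `(0,1)` the `∂/∂t` one. -/
def Codazzi (k : ℕ) (η : ℝ) (f11 f31 : ℝ → ℝ) (f12 f22 f32 : (Fin (k+1) → ℝ) → ℝ)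
    (U : Set (ℝ × ℝ)) (a b c : ℝ × ℝ → ℝ) : Prop :=
  ∀ p ∈ U, ∀ z : Fin (k+1) → ℝ,
    f11 (z 0) * fderiv ℝ a p (0, 1) + η * fderiv ℝ b p (0, 1)
      - f12 z * fderiv ℝ a p (1, 0) - f22 z * fderiv ℝ b p (1, 0)
      - 2 * b p * (f11 (z 0) * f32 z - f31 (z 0) * f12 z)
      + (a p - c p) * (η * f32 z - f31 (z 0) * f22 z) = 0 ∧
    f11 (z 0) * fderiv ℝ b p (0, 1) + η * fderiv ℝ c p (0, 1)
      - f12 z * fderiv ℝ b p (1, 0) - f22 z * fderiv ℝ c p (1, 0)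
      + (a p - c p) * (f11 (z 0) * f32 z - f31 (z 0) * f12 z)
      + 2 * b p * (η * f32 z - f31 (z 0) * f22 z) = 0

/-- The `i`-th coordinate direction. -/
def coordDir (n i : ℕ) : Fin n → ℝ := fun j => if (j : ℕ) = i then 1 else 0

theorem hasDerivAt_line {n : ℕ} {f : (Fin n → ℝ) → ℝ} (hf : Differentiable ℝ f)
    (z : Fin n → ℝ) (i : ℕ) (t : ℝ) :
    HasDerivAt (fun s : ℝ => f (z + s • coordDir n i)) (pd f (z + t • coordDir n i) i) t := by
  have h : HasDerivAt (fun s : ℝ => z + s • coordDir n i) (coordDir n i) t := by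
    simpa using ((hasDerivAt_id t).smul_const (coordDir n i)).const_add z
  exact (hf _).hasFDerivAt.comp_hasDerivAt t h

theorem pd_eq_of_line_linear {n : ℕ} {f : (Fin n → ℝ) → ℝ} (hf : Differentiable ℝ f)
    (z : Fin n → ℝ) (i : ℕ) (a c : ℝ)
    (h : ∀ t : ℝ, a * (f (z + t • coordDir n i) - f z) = t * c) : a * pd f z i = c := by
  have h1 := ((hasDerivAt_line hf z i 0).sub_const (f z)).const_mul a
  have h2 : HasDerivAt (fun t : ℝ => t * c) c 0 := by
    simpa using (hasDerivAt_id (0 : ℝ)).mul_const c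
  simp only [h, zero_smul, add_zero] at h1
  exact h1.unique h2

theorem line_const_of_pd_eq_zero {n : ℕ} {f : (Fin n → ℝ) → ℝ} (hf : Differentiable ℝ f)
    (i : ℕ) (h : ∀ z, pd f z i = 0) (z : Fin n → ℝ) (t : ℝ) :
    f (z + t • coordDir n i) = f z := by
  have := is_const_of_deriv_eq_zero (fun s => (hasDerivAt_line hf z i s).differentiableAt)
    (fun s => (hasDerivAt_line hf z i s).deriv.trans (h _)) t 0
  simpa using this

theorem DependsOnFirst.line_const {n m : ℕ} {f : (Fin n → ℝ) → ℝ} (hf : DependsOnFirst m f)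
    {i : ℕ} (hi : m ≤ i) (z : Fin n → ℝ) (t : ℝ) : f (z + t • coordDir n i) = f z := by
  refine hf _ _ fun j hj => ?_
  have : (j : ℕ) ≠ i := by omega
  simp [coordDir, this]

theorem pd_line_const {n : ℕ} {f : (Fin n → ℝ) → ℝ} {m : ℕ}
    (h : ∀ (z : Fin n → ℝ) (t : ℝ), f (z + t • coordDir n m) = f z)
    (z : Fin n → ℝ) (t : ℝ) (i : ℕ) : pd f (z + t • coordDir n m) i = pd f z i := by
  have h1 := fderiv_comp_add_right (𝕜 := ℝ) (f := f) (x := z) (t • coordDir n m)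
  simp only [h] at h1
  rw [pd, pd, ← h1]

theorem zc_add_smul_coordDir {n m : ℕ} (hm : m < n) (z : Fin n → ℝ) (t : ℝ) (i : ℕ) :
    zc (z + t • coordDir n m) i = zc z i + if i = m then t else 0 := by
  unfold zc coordDir
  by_cases h : i < n
  · simp [h]
  · have : i ≠ m := by omega
    simp [h, this]

theorem sum_pd_mul_zc_line {n : ℕ} {f : (Fin n → ℝ) → ℝ} {m N : ℕ} (hm : m + 1 < n) (hN : m < N)
    (h : ∀ (z : Fin n → ℝ) (t : ℝ), f (z + t • coordDir n (m + 1)) = f z)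
    (z : Fin n → ℝ) (t : ℝ) :
    ∑ i ∈ Finset.range N, pd f (z + t • coordDir n (m + 1)) i
        * zc (z + t • coordDir n (m + 1)) (i + 1) =
      ∑ i ∈ Finset.range N, pd f z i * zc z (i + 1) + t * pd f z m := by
  simp only [pd_line_const h, zc_add_smul_coordDir hm, mul_add, Finset.sum_add_distrib,
    add_left_inj, mul_ite, mul_zero, Finset.sum_ite_eq', Finset.mem_range, hN, if_true]
  ring

theorem pd_sub_const_mul {n : ℕ} {f g : (Fin n → ℝ) → ℝ} (hf : Differentiable ℝ f)
    (hg : Differentiable ℝ g) (c : ℝ) (z : Fin n → ℝ) (i : ℕ) :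
    pd (fun w => f w - c * g w) z i = pd f z i - c * pd g z i := by
  simp only [pd]
  rw [fderiv_fun_sub (hf z) ((hg z).const_mul c), fderiv_const_mul (hg z)]
  simp

/-- In branch II (`f31 = λ·f11`, `λ ≠ 0`, `λ² ≠ 1`, `f11` and
`f11'` nowhere zero), the structure equations with `∂F/∂z_k` nowhere zero force the
identities (i)–(iv) at every point. -/
theorem stmt10 (k : ℕ) (hk : 2 ≤ k) (η : ℝ) (hη : η ≠ 0)
    (f11 f31 : ℝ → ℝ) (f12 f22 f32 F : (Fin (k+1) → ℝ) → ℝ)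
    (hf11 : ContDiff ℝ (⊤ : ℕ∞) f11) (hf31 : ContDiff ℝ (⊤ : ℕ∞) f31)
    (hf12 : ContDiff ℝ (⊤ : ℕ∞) f12) (hf22 : ContDiff ℝ (⊤ : ℕ∞) f22)
    (hf32 : ContDiff ℝ (⊤ : ℕ∞) f32) (hF : ContDiff ℝ (⊤ : ℕ∞) F)
    (hdep12 : DependsOnFirst k f12) (hdep32 : DependsOnFirst k f32)
    (hdep22 : DependsOnFirst (k-1) f22)
    (hS : StructEqs k η f11 f31 f12 f22 f32 F)
    (hFk : ∀ z : Fin (k+1) → ℝ, pd F z k ≠ 0)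
    (lam : ℝ) (hlam0 : lam ≠ 0) (hlam1 : lam ^ 2 ≠ 1)
    (h31 : ∀ z0 : ℝ, f31 z0 = lam * f11 z0)
    (h11 : ∀ z0 : ℝ, f11 z0 ≠ 0) (h11d : ∀ z0 : ℝ, deriv f11 z0 ≠ 0) :
    ∀ z : Fin (k+1) → ℝ,
      pd f12 z (k-1) ≠ 0 ∧
      pd f32 z (k-1) = lam * pd f12 z (k-1) ∧
      pd f22 z (k-2) = 0 ∧
      (pd f32 z (k-2) - lam * pd f12 z (k-2) = η * (lam ^ 2 - 1) * pd f12 z (k-1) ∧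
        pd f32 z (k-2) - lam * pd f12 z (k-2) ≠ 0) := by
  obtain ⟨l, rfl⟩ : ∃ l, k = l + 2 := ⟨k - 2, by omega⟩
  simp only [show l + 2 - 1 = l + 1 by omega, show l + 2 - 2 = l by omega] at *
  have d12 : Differentiable ℝ f12 := hf12.differentiable (by simp)
  have d32 : Differentiable ℝ f32 := hf32.differentiable (by simp)
  have dF : Differentiable ℝ F := hF.differentiable (by simp)
  have d31 (x : ℝ) : deriv f31 x = lam * deriv f11 x := by
    rw [funext h31, deriv_const_mul _ (hf11.differentiable (by simp) x)]
  have z0 (z : Fin (l + 2 + 1) → ℝ) (t : ℝ) (i : ℕ) :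
      (z + t • coordDir (l + 2 + 1) (i + 1)) 0 = z 0 := by simp [coordDir]
  have c12 := hdep12.line_const le_rfl
  have c32 := hdep32.line_const le_rfl
  have c22 := hdep22.line_const le_rfl
  have c22' := hdep22.line_const (i := l + 2) (by omega)
  obtain ⟨g, hg⟩ : ∃ g : (Fin (l + 2 + 1) → ℝ) → ℝ, g = fun w => f32 w - lam * f12 w := ⟨_, rfl⟩
  have dg : Differentiable ℝ g := by rw [hg]; exact d32.sub (d12.const_mul lam)
  have pg (z i) : pd g z i = pd f32 z i - lam * pd f12 z i := by
    rw [hg]; exact pd_sub_const_mul d32 d12 lam z i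
  have gz (z) : g z = f32 z - lam * f12 z := by rw [hg]
  have cg (z : Fin (l + 2 + 1) → ℝ) (t : ℝ) : g (z + t • coordDir _ (l + 2)) = g z := by
    rw [gz, gz, c12, c32]
  have T (z : Fin (l + 2 + 1) → ℝ) : ∑ i ∈ Finset.range (l + 2), pd g z i * zc z (i + 1)
      + η * (f12 z - lam * f32 z) + (lam ^ 2 - 1) * f11 (z 0) * f22 z = 0 := by
    obtain ⟨h1, -, h3⟩ := hS z
    simp only [pg, sub_mul, Finset.sum_sub_distrib, mul_assoc, ← Finset.mul_sum]
    rw [d31] at h3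
    rw [h31] at h1
    linear_combination lam * h1 - h3
  have g1 (z : Fin (l + 2 + 1) → ℝ) : pd g z (l + 1) = 0 := by
    have h := T (z + (1 : ℝ) • coordDir _ (l + 2))
    rw [sum_pd_mul_zc_line (by omega) (by omega) cg, c12, c32, c22', z0] at h
    linear_combination h - T z
  have cg' := line_const_of_pd_eq_zero dg (l + 1) g1
  intro z
  have hi : pd f12 z (l + 1) ≠ 0 := by
    have h : deriv f11 (z 0) * pd F z (l + 2) = pd f12 z (l + 1) := by
      refine pd_eq_of_line_linear dF z _ _ _ fun t => ?_
      have h := (hS (z + t • coordDir _ (l + 2))).1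
      rw [sum_pd_mul_zc_line (by omega) (by omega) c12, c32, c22', z0] at h
      linear_combination h - (hS z).1
    rw [← h]
    exact mul_ne_zero (h11d _) (hFk z)
  have hiii : pd f22 z l = 0 := by
    have h := (hS (z + (1 : ℝ) • coordDir _ (l + 1))).2.1
    have h' := (hS z).2.1
    have e := cg' z 1
    rw [gz, gz] at e
    simp only [show l + 2 - 1 = l + 1 by omega] at h h'
    rw [sum_pd_mul_zc_line (by omega) (by omega) c22, z0, h31] at h
    rw [h31] at h'
    linear_combination h - h' + f11 (z 0) * e
  have hiv : pd f32 z l - lam * pd f12 z l = η * (lam ^ 2 - 1) * pd f12 z (l + 1) := by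
    rw [← pg]
    refine (pd_eq_of_line_linear d12 z _ _ _ fun t => ?_).symm
    have h := T (z + t • coordDir _ (l + 1))
    have e := cg' z t
    rw [gz, gz] at e
    rw [sum_pd_mul_zc_line (by omega) (by omega) cg', c22, z0] at h
    linear_combination T z - h - η * lam * e
  refine ⟨hi, ?_, hiii, hiv, ?_⟩
  · linear_combination (pg z (l + 1)).symm.trans (g1 z)
  · rw [hiv]
    exact mul_ne_zero (mul_ne_zero hη (sub_ne_zero.2 hlam1)) hi
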